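/- Descending summability of the coefficients (Lemma B.1, point 2): For all p₀, p ∈ P, Σ_{k₀ ∈ D_{p₀} ∩ [0,1)} Σ_{k ∈ D_p, k ≥ k₀} c(p,k;p₀,k₀) ≤ n_p · ((I−H)^{-1})_{p,p₀}, where the outer sum has exactly n_{p₀} terms and the inner sum is a sum in [0,∞] over the countable set D_p ∩ [k₀,∞). -/

import Mathlib

open scoped BigOperators ENNReal

attribute [local instance] Matrix.linftyOpNormedRing Matrix.linftyOpNormedAlgebra in
theorem aux_summable {P : Type*} [Fintype P] [DecidableEq P] (A : Matrix P P ℂ)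
    (hA : spectralRadius ℂ A < 1) : Summable (fun i : ℕ => A ^ i) := by
  have : CompleteSpace (Matrix P P ℂ) := FiniteDimensional.complete ℂ _
  obtain ⟨q, hq1, hq2⟩ := exists_between hA
  have hg := spectrum.pow_nnnorm_pow_one_div_tendsto_nhds_spectralRadius A
  have hev := hg.eventually (gt_mem_nhds hq1)
  have hqt : q ≠ ⊤ := ne_top_of_lt hq2
  lift q to NNReal using hqt
  have hq2' : (q : ℝ) < 1 := by exact_mod_cast hq2
  refine Summable.of_norm_bounded_eventually_nat (g := fun i => (q:ℝ) ^ i)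
    (summable_geometric_of_lt_one q.2 hq2') ?_
  filter_upwards [hev, Filter.eventually_gt_atTop 0] with i hi hi0
  have h1 : (‖A ^ i‖₊ : ℝ≥0∞) ≤ (q : ℝ≥0∞) ^ i := by
    have := ENNReal.rpow_le_rpow hi.le (z := (i:ℝ)) (by positivity)
    rw [← ENNReal.rpow_mul] at this
    have hi' : (i:ℝ) ≠ 0 := by positivity
    rw [one_div, inv_mul_cancel₀ hi', ENNReal.rpow_one, ENNReal.rpow_natCast] at this
    exact this
  have h2 : ‖A ^ i‖₊ ≤ q ^ i := by exact_mod_cast h1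
  exact_mod_cast h2

theorem aux_G {P : Type*} [Fintype P] [DecidableEq P] (Hm : Matrix P P ℝ)
    (hHm0 : ∀ p p', 0 ≤ Hm p p')
    (hspec : spectralRadius ℂ (Hm.map (algebraMap ℝ ℂ)) < 1) :
    (∀ p q, 0 ≤ (1 - Hm)⁻¹ p q) ∧ (1 - Hm)⁻¹ = 1 + Hm * (1 - Hm)⁻¹ := by
  have hs := aux_summable _ hspec
  have hpow : ∀ i : ℕ, (Hm.map (algebraMap ℝ ℂ)) ^ i = (Hm ^ i).map (algebraMap ℝ ℂ) := by
    intro i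
    exact (map_pow (algebraMap ℝ ℂ).mapMatrix Hm i).symm
  have hs' : Summable (fun i : ℕ => Hm ^ i) := by
    refine Pi.summable.2 fun p => Pi.summable.2 fun q => ?_
    have h1 := Pi.summable.1 (Pi.summable.1 hs p) q
    have h2 : (fun i : ℕ => ((Hm.map (algebraMap ℝ ℂ)) ^ i) p q)
        = fun i : ℕ => (((Hm ^ i) p q : ℝ) : ℂ) := by
      funext i; rw [hpow]; rfl
    rw [h2] at h1
    exact Complex.summable_ofReal.1 h1
  have hG : (1 - Hm) * ∑' i : ℕ, Hm ^ i = 1 := hs'.one_sub_mul_tsum_pow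
  have hinv := Matrix.inv_eq_right_inv hG
  rw [hinv]
  refine ⟨fun p q => ?_, ?_⟩
  · have h1 : (∑' i : ℕ, Hm ^ i) p q = ∑' i : ℕ, (Hm ^ i) p q := by
      exact (congrFun (tsum_apply (x := p) hs') q).trans (tsum_apply (Pi.summable.1 hs' p))
    rw [h1]
    clear h1
    refine tsum_nonneg fun i => ?_
    induction i generalizing p q with
    | zero => simp only [pow_zero, Matrix.one_apply]; split_ifs <;> norm_num
    | succ i ih =>
      rw [pow_succ, Matrix.mul_apply]
      exact Finset.sum_nonneg fun j _ => mul_nonneg (ih _ _) (hHm0 _ _)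
  · rw [sub_mul, one_mul] at hG
    exact (eq_add_of_sub_eq hG)

theorem aux_floor (f : ℝ → ℝ≥0∞) :
    ∑' x, f x = ∑' m : ℤ, ∑' r : ℝ, (Set.Ico (0:ℝ) 1).indicator (fun r => f (r + m)) r := by
  calc ∑' x, f x = ∑' x, ∑' m : ℤ, if m = ⌊x⌋ then f x else 0 := by
        refine tsum_congr fun x => ?_
        rw [tsum_ite_eq]
    _ = ∑' m : ℤ, ∑' x, if m = ⌊x⌋ then f x else 0 := ENNReal.tsum_comm
    _ = _ := by
        refine tsum_congr fun m => ?_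
        rw [← (Equiv.addRight (m:ℝ)).tsum_eq]
        refine tsum_congr fun r => ?_
        simp only [Equiv.coe_addRight, Int.floor_add_intCast, Set.indicator_apply]
        have : (m = ⌊r⌋ + m) ↔ r ∈ Set.Ico (0:ℝ) 1 := by
          rw [← Int.floor_eq_zero_iff]; omega
        simp only [this]

theorem aux_finsum (S : Set ℝ) (hS : S.Finite) (f : ℝ → ℝ) (hf : ∀ x ∈ S, 0 ≤ f x) :
    ENNReal.ofReal (∑ᶠ x ∈ S, f x) = ∑' x, S.indicator (fun x => ENNReal.ofReal (f x)) x := by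
  rw [finsum_mem_eq_finite_toFinset_sum f hS, ENNReal.ofReal_sum_of_nonneg (by simpa using hf),
    tsum_eq_sum (s := hS.toFinset)]
  · refine Finset.sum_congr rfl fun x hx => ?_
    rw [Set.indicator_of_mem (by simpa using hx)]
  · intro x hx
    rw [Set.indicator_of_notMem (by simpa using hx)]

/-- induction over a locally finite set -/
theorem aux_ind (E : Set ℝ) (hfin : ∀ u v : ℝ, u < v → (E ∩ Set.Ioc u v).Finite) (L : ℝ)
    (Q : ℝ → Prop) (step : ∀ k, L ≤ k → (∀ k', k' ∈ E → L ≤ k' → k' < k → Q k') → Q k) :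
    ∀ k, L ≤ k → Q k := by
  have hf : ∀ k, (E ∩ Set.Ico L k).Finite := fun k => by
    rcases lt_or_ge (L-1) k with hk | hk
    · refine (hfin (L-1) k hk).subset ?_
      rintro x ⟨hx, h1, h2⟩
      exact ⟨hx, by linarith, h2.le⟩
    · rw [Set.Ico_eq_empty (by linarith)]; simp
  have : ∀ N : ℕ, ∀ k, L ≤ k → (E ∩ Set.Ico L k).ncard = N → Q k := by
    intro N
    induction N using Nat.strong_induction_on with
    | _ N ih =>
      intro k hk hN
      refine step k hk fun k' hk' hL hlt => ?_
      refine ih _ ?_ k' hL rfl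
      rw [← hN]
      refine Set.ncard_lt_ncard ?_ (hf k)
      refine ⟨fun x hx => ⟨hx.1, hx.2.1, hx.2.2.trans hlt⟩, fun hc => ?_⟩
      exact lt_irrefl _ (hc ⟨hk', hL, hlt⟩).2.2
  exact fun k hk => this _ k hk rfl

/-- **Lemma B.1, point 2.** Descending summability of the coefficients. -/
theorem stmt_5
    {P : Type*} [Fintype P] [Nonempty P] [DecidableEq P]
    (n : P → ℕ) (hn : ∀ p, 1 ≤ n p)
    (θ : P → ℝ) (hθ0 : ∀ p, 0 ≤ θ p) (hθ1 : ∀ p, θ p < 1 / (n p : ℝ))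
    (D : P → Set ℝ)
    (hD : ∀ p, D p = {k : ℝ | ∃ j : ℤ, k = θ p + (j : ℝ) / (n p : ℝ)})
    (hfin : ∀ u v : ℝ, u < v → ((⋃ p, D p) ∩ Set.Ioc u v).Finite)
    (a : P → P → ℝ) (ha : ∀ p p', 0 ≤ a p p')
    (h : P → P → ℝ → ℝ) (hh : ∀ p p' x, 0 ≤ h p p' x)
    (hh0 : ∀ p p' x, x ≤ 0 → h p p' x = 0)
    -- the coefficients `c(p,k;p',k')`, characterized by the well-founded recursion
    (co : P → ℝ → P → ℝ → ℝ)
    (hco_nonneg : ∀ p k p' k', k ∈ D p → k' ∈ D p' → k' ≤ k → 0 ≤ co p k p' k')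
    (hco_diag : ∀ p p' k, k ∈ D p → k ∈ D p' → co p k p' k = if p = p' then 1 else 0)
    (hco_rec : ∀ p k p' k', k ∈ D p → k' ∈ D p' → k' < k →
      co p k p' k' = ∑ p'' : P, ∑ᶠ k'' ∈ D p'' ∩ Set.Ico k' k,
        a p p'' * h p p'' (k - k'') * co p'' k'' p' k')
    -- the matrix `H` of the interaction norms: its entries are finite reals
    (Hm : Matrix P P ℝ) (hHm0 : ∀ p p', 0 ≤ Hm p p')
    (hHm : ∀ p p', ENNReal.ofReal (Hm p p') =
      ENNReal.ofReal (a p p') *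
        ⨆ x : ℝ, ∑' j : ℤ, ENNReal.ofReal (h p p' (x + (j : ℝ) / (n p' : ℝ))))
    -- the spectral radius of `H` is strictly less than 1
    (hspec : spectralRadius ℂ (Hm.map (algebraMap ℝ ℂ)) < 1) :
    ∀ p₀ p : P,
      ∑' k₀ : (D p₀ ∩ Set.Ico (0 : ℝ) 1 : Set ℝ),
          ∑' k : (D p ∩ Set.Ici (k₀ : ℝ) : Set ℝ),
            ENNReal.ofReal (co p (k : ℝ) p₀ (k₀ : ℝ)) ≤
        (n p : ℝ≥0∞) * ENNReal.ofReal ((1 - Hm)⁻¹ p p₀) := by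
  intro p₀ p₁
  classical
  obtain ⟨hG0, hGeq⟩ := aux_G Hm hHm0 hspec
  set G := (1 - Hm)⁻¹ with hGdef
  have hnpos : ∀ p, (0:ℝ) < n p := fun p => by exact_mod_cast hn p
  have hinj : ∀ p, Function.Injective (fun j : ℤ => θ p + (j:ℝ) / (n p : ℝ)) := by
    intro p i j hij
    have := (hnpos p).ne'
    have h2 : (i:ℝ) / (n p : ℝ) = (j:ℝ) / (n p : ℝ) := by simpa using hij
    rw [div_left_inj' this] at h2
    exact_mod_cast h2
  have hDadd : ∀ p (k : ℝ) (m : ℤ), k ∈ D p → k + m ∈ D p := by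
    intro p k m hk
    rw [hD] at hk ⊢
    obtain ⟨j, rfl⟩ := hk
    refine ⟨j + m * n p, ?_⟩
    have := (hnpos p).ne'
    push_cast
    field_simp
    ring
  have hDiff : ∀ p (k : ℝ) (m : ℤ), k + m ∈ D p ↔ k ∈ D p := by
    intro p k m
    refine ⟨fun hk => ?_, hDadd p k m⟩
    have := hDadd p _ (-m) hk
    simpa using this
  have hfinS : ∀ p (u v : ℝ), (D p ∩ Set.Ico u v).Finite := by
    intro p u v
    rcases lt_or_ge (u-1) v with hk | hk
    · refine (hfin (u-1) v hk).subset ?_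
      rintro x ⟨hx, h1, h2⟩
      exact ⟨Set.mem_iUnion.2 ⟨p, hx⟩, by linarith, h2.le⟩
    · rw [Set.Ico_eq_empty (by linarith)]; simp
  -- translation invariance
  have htrans : ∀ p k p' k' (m : ℤ), k ∈ D p → k' ∈ D p' → k' ≤ k →
      co p (k + m) p' (k' + m) = co p k p' k' := by
    intro p k p' k' m hk hk' hle
    have key := aux_ind (⋃ p, D p) hfin k'
      (fun k => ∀ p, k ∈ D p → co p (k + m) p' (k' + m) = co p k p' k') ?_ k hle p hk
    · exact key
    intro k hle ih p hk
    rcases eq_or_lt_of_le hle with heq | hlt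
    · subst heq
      rw [hco_diag p p' _ hk hk', hco_diag p p' _ (hDadd _ _ _ hk) (hDadd _ _ _ hk')]
    · rw [hco_rec p k p' k' hk hk' hlt, hco_rec p (k+m) p' (k'+m) (hDadd _ _ _ hk)
        (hDadd _ _ _ hk') (by linarith)]
      refine Finset.sum_congr rfl fun q _ => ?_
      symm
      refine finsum_mem_eq_of_bijOn (fun x => x + (m:ℝ)) ⟨?_, ?_, ?_⟩ ?_
      · rintro x ⟨hx, h1, h2⟩
        exact ⟨hDadd _ _ _ hx, by simpa using h1, by simpa using h2⟩
      · intro x _ y _ hxy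
        simpa using hxy
      · rintro x ⟨hx, h1, h2⟩
        refine ⟨x - m, ⟨?_, by linarith, by linarith⟩, by simp⟩
        rw [← hDiff q _ m]; simpa using hx
      · rintro x ⟨hx, h1, h2⟩
        simp only [add_sub_add_right_eq_sub]
        rw [ih x (Set.mem_iUnion.2 ⟨q, hx⟩) h1 h2 q hx]
  -- truncated coefficients
  obtain ⟨F, hF⟩ : ∃ F : P → ℝ → ℝ → ℝ≥0∞, ∀ p k k₀, F p k k₀ =
      if k ∈ D p ∧ k₀ ∈ D p₀ ∧ k₀ ≤ k then ENNReal.ofReal (co p k p₀ k₀) else 0 :=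
    ⟨_, fun _ _ _ => rfl⟩
  have hFtrans : ∀ p k k₀ (m : ℤ), F p (k + m) k₀ = F p k (k₀ + ((-m : ℤ) : ℝ)) := by
    intro p k k₀ m
    rw [hF, hF, hDiff, hDiff]
    have e : (k₀ ≤ k + m) ↔ (k₀ + ((-m : ℤ) : ℝ)) ≤ k := by
      push_cast; constructor <;> intro <;> linarith
    simp only [e]
    split_ifs with hc
    · congr 1
      have := htrans p k p₀ (k₀ + ((-m : ℤ) : ℝ)) m hc.1 (hDadd _ _ _ hc.2.1) hc.2.2
      rw [← this]
      congr 1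
      push_cast; ring
    · rfl
  obtain ⟨W, hW⟩ : ∃ W : P → P → ℝ → ℝ → ℝ≥0∞, ∀ p q k k', W p q k k' =
      if k' ∈ D q ∧ k' < k then ENNReal.ofReal (a p q) * ENNReal.ofReal (h p q (k - k')) else 0 :=
    ⟨_, fun _ _ _ _ => rfl⟩
  have hWsum : ∀ p q k, ∑' k', W p q k k' ≤ ENNReal.ofReal (Hm p q) := by
    intro p q k
    rw [hHm]
    calc ∑' k', W p q k k' ≤ ∑' k', ENNReal.ofReal (a p q) *
          (D q).indicator (fun k' => ENNReal.ofReal (h p q (k - k'))) k' := by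
          refine ENNReal.tsum_le_tsum fun k' => ?_
          rw [hW, Set.indicator_apply]
          split_ifs with h1 h2 h2
          · exact le_rfl
          · exact absurd h1.1 h2
          · exact zero_le
          · exact zero_le
      _ = ENNReal.ofReal (a p q) *
          ∑' k', (D q).indicator (fun k' => ENNReal.ofReal (h p q (k - k'))) k' :=
          ENNReal.tsum_mul_left
      _ ≤ _ := by
          gcongr
          have hr : D q = Set.range (fun j : ℤ => θ q + (j:ℝ) / (n q : ℝ)) := by
            rw [hD]; ext x; simp [eq_comm]
          rw [← tsum_subtype (D q) (fun k' => ENNReal.ofReal (h p q (k - k'))), hr,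
            tsum_range (fun k' => ENNReal.ofReal (h p q (k - k'))) (hinj q),
            ← (Equiv.neg ℤ).tsum_eq]
          refine le_trans (le_of_eq ?_) (le_iSup _ (k - θ q))
          refine tsum_congr fun j => ?_
          congr 2
          simp only [Equiv.neg_apply]
          push_cast; ring
  have hFrec : ∀ p k k₀, F p k k₀ ≤ (if k₀ = k then (if p = p₀ then 1 else 0) else 0) +
      ∑ q, ∑' k', W p q k k' * F q k' k₀ := by
    intro p k k₀
    rw [hF]
    split_ifs with hc h1 h2 h2
    · rw [h1, hco_diag p p₀ k hc.1 (h1 ▸ hc.2.1), if_pos h2]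
      simp
    · rw [h1, hco_diag p p₀ k hc.1 (h1 ▸ hc.2.1), if_neg h2]
      simp
    · rw [zero_add]
      have hlt : k₀ < k := lt_of_le_of_ne hc.2.2 h1
      have hnn : ∀ q, ∀ x ∈ D q ∩ Set.Ico k₀ k, 0 ≤ a p q * h p q (k - x) * co q x p₀ k₀ :=
        fun q x hx => mul_nonneg (mul_nonneg (ha _ _) (hh _ _ _))
          (hco_nonneg _ _ _ _ hx.1 hc.2.1 hx.2.1)
      rw [hco_rec p k p₀ k₀ hc.1 hc.2.1 hlt, ENNReal.ofReal_sum_of_nonneg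
        (fun q _ => finsum_nonneg fun x => finsum_nonneg fun hx => hnn q x hx)]
      refine Finset.sum_le_sum fun q _ => ?_
      rw [aux_finsum _ (hfinS _ _ _) _ (hnn q)]
      refine ENNReal.tsum_le_tsum fun x => ?_
      rw [Set.indicator_apply]
      split_ifs with hx
      · rw [hW, hF, if_pos ⟨hx.1, hx.2.2⟩, if_pos ⟨hx.1, hc.2.1, hx.2.1⟩,
          ENNReal.ofReal_mul (mul_nonneg (ha _ _) (hh _ _ _)), ENNReal.ofReal_mul (ha _ _)]
      · exact zero_le
    all_goals exact zero_le
  -- ascending bound, truncated below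
  have hT : ∀ L k, L ≤ k → ∀ p, ∑' k₀, (Set.Ici L).indicator (F p k) k₀
      ≤ ENNReal.ofReal (G p p₀) := by
    intro L
    refine aux_ind (⋃ p, D p) hfin L _ ?_
    intro k hLk ih p
    calc ∑' k₀, (Set.Ici L).indicator (F p k) k₀
        ≤ ∑' k₀, ((if k₀ = k then (if p = p₀ then 1 else 0) else 0) +
          ∑ q, ∑' k', W p q k k' * (Set.Ici L).indicator (F q k') k₀) := by
          refine ENNReal.tsum_le_tsum fun k₀ => ?_
          by_cases hL : k₀ ∈ Set.Ici L
          · simp only [Set.indicator_of_mem hL]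
            exact hFrec p k k₀
          · simp only [Set.indicator_of_notMem hL]
            exact zero_le
      _ = (if p = p₀ then 1 else 0) +
          ∑ q, ∑' k', W p q k k' * ∑' k₀, (Set.Ici L).indicator (F q k') k₀ := by
          rw [ENNReal.tsum_add, tsum_ite_eq]
          congr 1
          rw [Summable.tsum_finsetSum (fun _ _ => ENNReal.summable)]
          refine Finset.sum_congr rfl fun q _ => ?_
          rw [ENNReal.tsum_comm]
          refine tsum_congr fun k' => ?_
          rw [ENNReal.tsum_mul_left]
      _ ≤ (if p = p₀ then 1 else 0) + ∑ q, ∑' k', W p q k k' * ENNReal.ofReal (G q p₀) := by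
          refine add_le_add le_rfl (Finset.sum_le_sum fun q _ => ENNReal.tsum_le_tsum fun k' => ?_)
          rw [hW]
          split_ifs with hc
          · gcongr
            rcases le_or_gt L k' with hL | hL
            · exact ih k' (Set.mem_iUnion.2 ⟨q, hc.1⟩) hL hc.2 q
            · refine le_trans (le_of_eq ?_) zero_le
              rw [ENNReal.tsum_eq_zero]
              intro k₀
              rw [Set.indicator_apply]
              split_ifs with h1
              · rw [hF, if_neg]
                rintro ⟨_, _, h2⟩
                exact absurd (lt_of_lt_of_le hL h1) (not_lt.2 h2)
              · rfl
          · simp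
      _ ≤ (if p = p₀ then 1 else 0) +
          ∑ q, ENNReal.ofReal (Hm p q) * ENNReal.ofReal (G q p₀) := by
          gcongr with q _
          rw [ENNReal.tsum_mul_right]
          gcongr
          exact hWsum p q k
      _ = ENNReal.ofReal (G p p₀) := by
          conv_rhs => rw [hGeq]
          rw [Matrix.add_apply, Matrix.mul_apply, ENNReal.ofReal_add,
            ENNReal.ofReal_sum_of_nonneg (fun q _ => mul_nonneg (hHm0 _ _) (hG0 _ _))]
          · congr 1
            · rw [Matrix.one_apply]; split_ifs <;> simp
            · exact Finset.sum_congr rfl fun q _ => (ENNReal.ofReal_mul (hHm0 _ _)).symm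
          · rw [Matrix.one_apply]; split_ifs <;> norm_num
          · exact Finset.sum_nonneg fun q _ => mul_nonneg (hHm0 _ _) (hG0 _ _)
  have hasc : ∀ p k, ∑' k₀, F p k k₀ ≤ ENNReal.ofReal (G p p₀) := by
    intro p k
    rw [ENNReal.tsum_eq_iSup_sum]
    refine iSup_le fun s => ?_
    obtain ⟨L, hL⟩ := (insert k s).bddBelow
    have hLk : L ≤ k := hL (by simp)
    refine le_trans ?_ (hT L k hLk p)
    refine le_trans (le_of_eq ?_) (ENNReal.sum_le_tsum s)
    refine Finset.sum_congr rfl fun x hx => ?_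
    rw [Set.indicator_of_mem]
    exact hL (by simp [hx])
  have hcount : ∑' r : ℝ, (D p₁ ∩ Set.Ico (0:ℝ) 1).indicator (fun _ => (1:ℝ≥0∞)) r ≤ n p₁ := by
    have hsub : D p₁ ∩ Set.Ico (0:ℝ) 1 ⊆
        ((Finset.range (n p₁)).image (fun j : ℕ => θ p₁ + (j:ℝ) / (n p₁ : ℝ)) : Finset ℝ) := by
      rintro x ⟨hx, h0, h1⟩
      rw [hD] at hx
      obtain ⟨j, rfl⟩ := hx
      have hp := hnpos p₁
      have hj0 : 0 ≤ j := by
        by_contra hneg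
        have h3 : (j:ℝ) ≤ -1 := by exact_mod_cast (by omega : j ≤ -1)
        have h4 : (j:ℝ) / n p₁ ≤ -1 / n p₁ := by gcongr
        have h5 := hθ1 p₁
        rw [neg_div] at h4
        linarith
      have hjn : j < n p₁ := by
        have h3 : (j:ℝ) / n p₁ < 1 := by linarith [hθ0 p₁]
        rw [div_lt_one hp] at h3
        exact_mod_cast h3
      lift j to ℕ using hj0
      simp only [Finset.coe_image, Set.mem_image, Finset.mem_coe, Finset.mem_range]
      exact ⟨j, by exact_mod_cast hjn, by simp⟩
    set S := (Finset.range (n p₁)).image (fun j : ℕ => θ p₁ + (j:ℝ) / (n p₁ : ℝ))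
    have hcard : S.card ≤ n p₁ := Finset.card_image_le.trans (by simp)
    rw [tsum_eq_sum (s := S)]
    · calc _ ≤ ∑ x ∈ S, (1:ℝ≥0∞) := by
            refine Finset.sum_le_sum fun x _ => ?_
            rw [Set.indicator_apply]; split_ifs <;> simp
        _ ≤ _ := by simpa using hcard
    · intro x hx
      rw [Set.indicator_of_notMem]
      exact fun hc => hx (hsub hc)
  calc ∑' k₀ : (D p₀ ∩ Set.Ico (0 : ℝ) 1 : Set ℝ),
          ∑' k : (D p₁ ∩ Set.Ici (k₀ : ℝ) : Set ℝ), ENNReal.ofReal (co p₁ (k : ℝ) p₀ (k₀ : ℝ))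
      = ∑' k₀ : (D p₀ ∩ Set.Ico (0 : ℝ) 1 : Set ℝ), ∑' k : ℝ, F p₁ k k₀ := by
        refine tsum_congr fun k₀ => ?_
        rw [tsum_subtype (D p₁ ∩ Set.Ici (k₀ : ℝ))
          (fun k => ENNReal.ofReal (co p₁ k p₀ (k₀ : ℝ)))]
        refine tsum_congr fun k => ?_
        rw [hF, Set.indicator_apply]
        have hm : (k ∈ D p₁ ∩ Set.Ici (k₀:ℝ)) ↔ (k ∈ D p₁ ∧ (k₀:ℝ) ∈ D p₀ ∧ (k₀:ℝ) ≤ k) :=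
          ⟨fun hx => ⟨hx.1, k₀.2.1, hx.2⟩, fun hx => ⟨hx.1, hx.2.2⟩⟩
        simp only [hm]
    _ = ∑' k₀ : ℝ, (D p₀ ∩ Set.Ico (0 : ℝ) 1).indicator (fun k₀ => ∑' k : ℝ, F p₁ k k₀) k₀ :=
        tsum_subtype (D p₀ ∩ Set.Ico (0 : ℝ) 1) (fun k₀ => ∑' k : ℝ, F p₁ k k₀)
    _ ≤ ∑' k₀ : ℝ, ∑' m : ℤ, ∑' r : ℝ, (Set.Ico (0:ℝ) 1).indicator
          (fun r => (Set.Ico (0:ℝ) 1).indicator (fun k₀ => F p₁ r (k₀ + ((-m : ℤ) : ℝ))) k₀) r := by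
        refine ENNReal.tsum_le_tsum fun k₀ => ?_
        rw [Set.indicator_apply]
        split_ifs with hk
        · rw [aux_floor]
          refine ENNReal.tsum_le_tsum fun m => ENNReal.tsum_le_tsum fun r => ?_
          simp only [Set.indicator_of_mem hk.2, hFtrans]
          exact le_rfl
        · exact zero_le
    _ = ∑' r : ℝ, ∑' m : ℤ, ∑' k₀ : ℝ, (Set.Ico (0:ℝ) 1).indicator
          (fun r => (Set.Ico (0:ℝ) 1).indicator (fun k₀ => F p₁ r (k₀ + ((-m : ℤ) : ℝ))) k₀) r := by
        rw [ENNReal.tsum_comm]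
        rw [ENNReal.tsum_comm (α := ℝ) (β := ℤ)]
        exact tsum_congr fun m => ENNReal.tsum_comm
    _ = ∑' r : ℝ, (Set.Ico (0:ℝ) 1).indicator (fun r => ∑' k₀, F p₁ r k₀) r := by
        refine tsum_congr fun r => ?_
        by_cases hr : r ∈ Set.Ico (0:ℝ) 1
        · simp only [Set.indicator_of_mem hr]
          rw [aux_floor (F p₁ r), ← (Equiv.neg ℤ).tsum_eq]
          simp only [Equiv.neg_apply, neg_neg]
        · simp only [Set.indicator_of_notMem hr]
          simp
    _ ≤ ∑' r : ℝ, (D p₁ ∩ Set.Ico (0:ℝ) 1).indicator (fun _ => (1:ℝ≥0∞)) r *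
          ENNReal.ofReal (G p₁ p₀) := by
        refine ENNReal.tsum_le_tsum fun r => ?_
        rw [Set.indicator_apply]
        split_ifs with hr
        · by_cases hrD : r ∈ D p₁
          · rw [Set.indicator_of_mem (s := D p₁ ∩ Set.Ico (0:ℝ) 1) ⟨hrD, hr⟩, one_mul]
            exact hasc p₁ r
          · refine le_trans (le_of_eq ?_) zero_le
            rw [ENNReal.tsum_eq_zero]
            intro k₀
            rw [hF, if_neg (fun hc => hrD hc.1)]
        · exact zero_le
    _ ≤ (n p₁ : ℝ≥0∞) * ENNReal.ofReal (G p₁ p₀) := by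
        rw [ENNReal.tsum_mul_right]
        gcongr
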